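/- Let L be an n×n real Laplacian matrix with eigenprojection L^⊢, let v ∈ ℝⁿ be a distribution vector (vᵢ ≥ 0, Σᵢ vᵢ = 1), and set D = I − 𝟏vᵀ. Then the eigenprojection of L + δD converges, as δ → 0⁺, to 𝟏 vᵀ L^⊢; that is, lim_{δ→0⁺} 𝟏 vᵀ (I + (1/δ)L)^{−1} = 𝟏 vᵀ L^⊢. -/

import Mathlib

open Matrix Filter Topology

/-- `L` is the Laplacian matrix of a weighted digraph: off-diagonal entries are
nonpositive and every row sum is zero. -/
def IsLaplacian {m : Type*} [Fintype m] [DecidableEq m] (L : Matrix m m ℝ) : Prop :=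
  (∀ i j, i ≠ j → L i j ≤ 0) ∧ (∀ i, ∑ j, L i j = 0)

/-- `P` is the eigenprojection of the square matrix `M` at eigenvalue `0`:
`P` is idempotent, its range is the kernel of `M ^ k` and its kernel is the range
of `M ^ k`, where `k` is the size of the matrix. -/
def IsEigenprojection {m : Type*} [Fintype m] [DecidableEq m] (M P : Matrix m m ℝ) : Prop :=
  P * P = P ∧
  LinearMap.range P.mulVecLin = LinearMap.ker (M ^ Fintype.card m).mulVecLin ∧
  LinearMap.ker P.mulVecLin = LinearMap.range (M ^ Fintype.card m).mulVecLin

theorem IsEigenprojection.exists_one_sub_eq_mul {m : Type*} [Fintype m] [DecidableEq m]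
    {M P : Matrix m m ℝ} (hP : IsEigenprojection M P) : ∃ X, 1 - P = M * X := by
  cases isEmpty_or_nonempty m
  · exact ⟨0, Subsingleton.elim _ _⟩
  obtain ⟨k, hk⟩ := Nat.exists_eq_succ_of_ne_zero (Fintype.card_ne_zero (α := m))
  have hcol : ∀ j, ∃ y, (M ^ (k + 1)) *ᵥ y = (1 - P) *ᵥ Pi.single j 1 := by
    intro j
    have hmem : (1 - P) *ᵥ Pi.single j 1 ∈ LinearMap.ker P.mulVecLin := by
      rw [LinearMap.mem_ker, mulVecLin_apply, mulVec_mulVec, mul_sub, mul_one, hP.1, sub_self,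
        zero_mulVec]
    rw [hP.2.2, hk] at hmem
    exact hmem
  choose y hy using hcol
  refine ⟨M ^ k * (of y)ᵀ, ext_of_mulVec_single fun j => ?_⟩
  rw [← mul_assoc, ← pow_succ', ← mulVec_mulVec, ← hy j, mulVec_single_one]
  rfl

namespace IsLaplacian

variable {m : Type*} [Fintype m] [DecidableEq m] {L P : Matrix m m ℝ}

/-- Maximum principle for `1 + t • L`. -/
theorem le_of_one_add_smul_mulVec_le (hL : IsLaplacian L) {t : ℝ} (ht : 0 ≤ t) {x : m → ℝ}
    {c : ℝ} (h : ∀ i, ((1 + t • L) *ᵥ x) i ≤ c) (i : m) : x i ≤ c := by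
  have : Nonempty m := ⟨i⟩
  obtain ⟨k, hk⟩ := Finite.exists_max x
  have hLx : 0 ≤ (L *ᵥ x) k := by
    have h0 : (L *ᵥ x) k = ∑ j, L k j * (x j - x k) := by
      simp only [mul_sub, Finset.sum_sub_distrib, ← Finset.sum_mul, hL.2 k, zero_mul, sub_zero]
      rfl
    rw [h0]
    refine Finset.sum_nonneg fun j _ => ?_
    rcases eq_or_ne k j with rfl | hj
    · simp
    · exact mul_nonneg_of_nonpos_of_nonpos (hL.1 k j hj) (sub_nonpos.2 (hk j))
  have hk' := h k
  simp only [add_mulVec, one_mulVec, smul_mulVec, Pi.add_apply, Pi.smul_apply,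
    smul_eq_mul] at hk'
  nlinarith [hk i, mul_nonneg ht hLx]

theorem abs_le_of_abs_one_add_smul_mulVec_le (hL : IsLaplacian L) {t : ℝ} (ht : 0 ≤ t)
    {x : m → ℝ} {c : ℝ} (h : ∀ i, |((1 + t • L) *ᵥ x) i| ≤ c) (i : m) : |x i| ≤ c := by
  refine abs_le'.2 ⟨hL.le_of_one_add_smul_mulVec_le ht (fun j => (abs_le'.1 (h j)).1) i, ?_⟩
  refine hL.le_of_one_add_smul_mulVec_le (x := -x) ht (fun j => ?_) i
  rw [mulVec_neg]
  exact (abs_le'.1 (h j)).2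

theorem isUnit_one_add_smul (hL : IsLaplacian L) {t : ℝ} (ht : 0 ≤ t) :
    IsUnit (1 + t • L) := by
  rw [← mulVec_injective_iff_isUnit]
  intro x y hxy
  ext i
  have h : (1 + t • L) *ᵥ (x - y) = 0 := by
    rw [mulVec_sub]
    exact sub_eq_zero.2 hxy
  have h0 := hL.abs_le_of_abs_one_add_smul_mulVec_le ht (x := x - y) (c := 0) (by simp [h]) i
  exact sub_eq_zero.1 (abs_nonpos_iff.1 h0)

theorem abs_inv_one_add_smul_apply_le (hL : IsLaplacian L) {t : ℝ} (ht : 0 ≤ t) (i j : m) :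
    |(1 + t • L)⁻¹ i j| ≤ 1 := by
  have hdet := (isUnit_iff_isUnit_det _).1 (hL.isUnit_one_add_smul ht)
  refine hL.abs_le_of_abs_one_add_smul_mulVec_le ht (x := fun k => (1 + t • L)⁻¹ k j)
    (fun k => ?_) i
  change |((1 + t • L) * (1 + t • L)⁻¹) k j| ≤ 1
  rw [mul_nonsing_inv _ hdet, one_apply]
  split_ifs <;> simp

theorem mulVec_eq_zero_of_mulVec_mulVec_eq_zero (hL : IsLaplacian L) {x : m → ℝ}
    (h : L *ᵥ (L *ᵥ x) = 0) : L *ᵥ x = 0 := by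
  ext i
  by_contra hne
  have hpos : 0 < |(L *ᵥ x) i| := abs_pos.2 hne
  set c := ∑ j, |x j|
  have hx : ∀ j, |x j| ≤ c := fun j =>
    Finset.single_le_sum (f := fun j => |x j|) (fun _ _ => abs_nonneg _) (Finset.mem_univ j)
  have hc : 0 ≤ c := (abs_nonneg _).trans (hx i)
  have key : ∀ t : ℝ, 0 ≤ t → t * |(L *ᵥ x) i| ≤ 2 * c := by
    intro t ht
    have heq : (1 + t • L) *ᵥ (x - t • (L *ᵥ x)) = x := by
      rw [add_mulVec, one_mulVec, smul_mulVec, mulVec_sub, mulVec_smul, h, smul_zero, sub_zero,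
        sub_add_cancel]
    have hb := hL.abs_le_of_abs_one_add_smul_mulVec_le ht (c := c)
      (x := x - t • (L *ᵥ x)) (by rw [heq]; exact hx) i
    have htri := abs_sub (x i) ((x - t • (L *ᵥ x)) i)
    have hsub : x i - (x - t • (L *ᵥ x)) i = t * (L *ᵥ x) i := by simp
    rw [hsub, abs_mul, abs_of_nonneg ht] at htri
    linarith [hx i]
  have h1 := key ((2 * c + 1) / |(L *ᵥ x) i|) (by positivity)
  rw [div_mul_cancel₀ _ hpos.ne'] at h1
  linarith

theorem mulVec_eq_zero_of_pow_mulVec_eq_zero (hL : IsLaplacian L) {x : m → ℝ} (k : ℕ)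
    (h : (L ^ k) *ᵥ x = 0) : L *ᵥ x = 0 := by
  induction k generalizing x with
  | zero =>
    rw [pow_zero, one_mulVec] at h
    rw [h, mulVec_zero]
  | succ k ih =>
    rw [pow_succ, ← mulVec_mulVec] at h
    exact hL.mulVec_eq_zero_of_mulVec_mulVec_eq_zero (ih h)

theorem mul_eigenprojection (hL : IsLaplacian L) (hP : IsEigenprojection L P) : L * P = 0 := by
  refine ext_of_mulVec_single fun j => ?_
  rw [← mulVec_mulVec, zero_mulVec]
  refine hL.mulVec_eq_zero_of_pow_mulVec_eq_zero (Fintype.card m) ?_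
  have hmem : P *ᵥ Pi.single j 1 ∈ LinearMap.range P.mulVecLin := ⟨_, rfl⟩
  rw [hP.2.1] at hmem
  exact hmem

/-- The resolvents `(1 + δ⁻¹ • L)⁻¹` of a Laplacian matrix converge to its eigenprojection
as `δ → 0⁺`. -/
theorem tendsto_inv_one_add_inv_smul (hL : IsLaplacian L) (hP : IsEigenprojection L P) :
    Tendsto (fun δ : ℝ => (1 + δ⁻¹ • L)⁻¹) (𝓝[>] 0) (𝓝 P) := by
  obtain ⟨X, hX⟩ := hP.exists_one_sub_eq_mul
  have heq : ∀ δ : ℝ, 0 < δ →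
      (1 + δ⁻¹ • L)⁻¹ = P + δ • ((1 - (1 + δ⁻¹ • L)⁻¹) * X) := by
    intro δ hδ
    have hdet := (isUnit_iff_isUnit_det _).1 (hL.isUnit_one_add_smul (inv_nonneg.2 hδ.le))
    have hinv := nonsing_inv_mul _ hdet
    set R := (1 + δ⁻¹ • L)⁻¹
    have hRP : R * P = P := by
      have h : (1 + δ⁻¹ • L) * P = P := by
        rw [add_mul, one_mul, smul_mul_assoc, hL.mul_eigenprojection hP, smul_zero, add_zero]
      calc R * P = R * ((1 + δ⁻¹ • L) * P) := by rw [h]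
        _ = P := by rw [← mul_assoc, hinv, one_mul]
    have hRL : R * L = δ • (1 - R) := by
      rw [← hinv, mul_add, mul_one, add_sub_cancel_left, mul_smul_comm, smul_smul,
        mul_inv_cancel₀ hδ.ne', one_smul]
    calc R = R * P + R * (1 - P) := by rw [← mul_add, add_sub_cancel, mul_one]
      _ = _ := by rw [hRP, hX, ← mul_assoc, hRL, smul_mul_assoc]
  have hzero : Tendsto (fun δ : ℝ => δ • ((1 - (1 + δ⁻¹ • L)⁻¹) * X)) (𝓝[>] 0) (𝓝 0) := by
    refine tendsto_pi_nhds.2 fun i => tendsto_pi_nhds.2 fun j => ?_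
    have hlim : Tendsto (fun δ : ℝ => δ * ∑ k, 2 * |X k j|) (𝓝[>] 0) (𝓝 0) := by
      have hcont : Continuous fun δ : ℝ => δ * ∑ k, 2 * |X k j| := by fun_prop
      simpa using (hcont.tendsto 0).mono_left nhdsWithin_le_nhds
    refine squeeze_zero_norm' ?_ hlim
    filter_upwards [self_mem_nhdsWithin] with δ hδ
    have hδ' : (0 : ℝ) < δ := hδ
    rw [Matrix.smul_apply, smul_eq_mul, Real.norm_eq_abs, abs_mul, abs_of_pos hδ', mul_apply]
    refine mul_le_mul_of_nonneg_left ((Finset.abs_sum_le_sum_abs _ _).trans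
      (Finset.sum_le_sum fun k _ => ?_)) hδ'.le
    rw [abs_mul]
    refine mul_le_mul_of_nonneg_right ?_ (abs_nonneg _)
    have hR := hL.abs_inv_one_add_smul_apply_le (inv_nonneg.2 hδ'.le) i k
    have h1 : |(1 : Matrix m m ℝ) i k| ≤ 1 := by
      rw [one_apply]
      split_ifs <;> simp
    rw [Matrix.sub_apply]
    linarith [abs_sub ((1 : Matrix m m ℝ) i k) ((1 + δ⁻¹ • L)⁻¹ i k)]
  have hsum := (tendsto_const_nhds (x := P)).add hzero
  rw [add_zero] at hsum
  refine hsum.congr' ?_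
  filter_upwards [self_mem_nhdsWithin] with δ hδ
  exact (heq δ hδ).symm

end IsLaplacian

/-- Lemma 3(2): as `δ → 0⁺`, the eigenprojection `𝟏 vᵀ (I + (1/δ)L)⁻¹` of
`L + δ D` converges to `𝟏 vᵀ L^⊢`. -/
theorem background_eigenprojection_limit {n : ℕ} (L P : Matrix (Fin n) (Fin n) ℝ)
    (hL : IsLaplacian L) (hP : IsEigenprojection L P)
    (v : Fin n → ℝ) (hv : ∀ i, 0 ≤ v i) (hv1 : ∑ i, v i = 1)
    (D : Matrix (Fin n) (Fin n) ℝ) (hD : D = 1 - vecMulVec 1 v) :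
    Tendsto (fun δ : ℝ => vecMulVec (1 : Fin n → ℝ) v * (1 + δ⁻¹ • L)⁻¹) (𝓝[>] 0)
      (𝓝 (vecMulVec (1 : Fin n → ℝ) v * P)) := by
  exact ((continuous_const.matrix_mul continuous_id).tendsto P).comp
    (hL.tendsto_inv_one_add_inv_smul hP)
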